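/- For every fixed integer t ≥ 1 there exists a constant C depending only on t such that for all n, the number of ordered triples (σ, π, τ) ∈ S_n × S_n × S_n satisfying d_U(σ,π) ≤ t, d_U(π,τ) ≤ t, and d_U(σ,τ) ≤ t is at most C · n! · n^{3t}. -/

import Mathlib

open scoped Classical

/-- A translocation: move the symbol at (0-indexed) position `i` to position `j`,
shifting intermediate symbols by one position. -/
def translocate {α : Type*} (l : List α) (i j : ℕ) : List α :=
  match l[i]? with
  | some a => (l.eraseIdx i).insertIdx j a
  | none => l

/-- The Ulam distance between two sequences: the minimum number of translocations
needed to transform `x` into `y`. -/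
noncomputable def ulamDist {α : Type*} (x y : List α) : ℕ :=
  sInf {m | ∃ g : ℕ → List α, g 0 = x ∧ g m = y ∧
    ∀ k < m, ∃ i j, i < (g k).length ∧ j < (g k).length ∧ i ≠ j ∧
      g (k+1) = translocate (g k) i j}

/-- The sequence form of a permutation of `{1,...,n}` (values written `1`-indexed). -/
def seqOf {n : ℕ} (π : Equiv.Perm (Fin n)) : List ℕ :=
  List.ofFn fun i => (π i : ℕ) + 1

/-- The Ulam distance between two permutations. -/
noncomputable def dU {n : ℕ} (π σ : Equiv.Perm (Fin n)) : ℕ :=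
  ulamDist (seqOf π) (seqOf σ)

/-- Length of a longest common subsequence of two sequences. -/
noncomputable def lcsLen {α : Type*} (x y : List α) : ℕ :=
  sSup {k | ∃ z : List α, z.Sublist x ∧ z.Sublist y ∧ z.length = k}

/-- Levenshtein distance: minimum number of insertions and deletions needed to
transform `x` into `y`. -/
noncomputable def levDist {α : Type*} (x y : List α) : ℕ :=
  sInf {m | ∃ g : ℕ → List α, g 0 = x ∧ g m = y ∧
    ∀ k < m, (∃ i a, i ≤ (g k).length ∧ g (k+1) = (g k).insertIdx i a) ∨
      (∃ i, i < (g k).length ∧ g (k+1) = (g k).eraseIdx i)}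

/-- Hamming distance between two permutations: number of positions where they differ. -/
def dH {m : ℕ} (a b : Equiv.Perm (Fin m)) : ℕ :=
  (Finset.univ.filter fun i => a i ≠ b i).card

/-- `bar π` = the permutation `π` of `{1,...,n}` extended to `{1,...,n+1}` by
appending the symbol `n+1` at the end (i.e. fixing the last point). -/
def bar {n : ℕ} (π : Equiv.Perm (Fin n)) : Equiv.Perm (Fin (n+1)) :=
  (Equiv.permCongr finSuccEquivLast).symm π.optionCongr

/-- The map `f : S_n → S_{n+1}`: `fmap π` sends each symbol `i` to the symbol
that cyclically follows `i` in the sequence form of `bar π`, i.e.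
`f(π̄)_i = π̄_{π̄⁻¹(i)+1}` for `i ≤ n` and `f(π̄)_{n+1} = π̄_1`. -/
def fmap {n : ℕ} (π : Equiv.Perm (Fin n)) : Equiv.Perm (Fin (n+1)) :=
  bar π * finRotate (n+1) * (bar π)⁻¹

/-- The deletion ball `D_t(π)`: all sequences of length `n - t` obtained from `π`
by deleting `t` symbols, i.e. all subsequences of `π` of length `n - t`. -/
def Dball {n : ℕ} (t : ℕ) (π : Equiv.Perm (Fin n)) : Set (List ℕ) :=
  {s | s.Sublist (seqOf π) ∧ s.length = n - t}

/-- `Mnt n t`: the maximum size of a subset of `S_n` whose distinct elements have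
pairwise Ulam distance greater than `t`. -/
noncomputable def Mnt (n t : ℕ) : ℕ :=
  sSup {m | ∃ C : Finset (Equiv.Perm (Fin n)),
    (∀ π ∈ C, ∀ σ ∈ C, π ≠ σ → t < dU π σ) ∧ C.card = m}

/-- One translocation step between sequences. -/
def TranslocStep {α : Type*} (x y : List α) : Prop :=
  ∃ i j, i < x.length ∧ j < x.length ∧ i ≠ j ∧ y = translocate x i j

theorem TranslocStep.cons {α : Type*} (a : α) {x y : List α} (h : TranslocStep x y) :
    TranslocStep (a :: x) (a :: y) := by
  obtain ⟨i, j, hi, hj, hij, rfl⟩ := h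
  refine ⟨i + 1, j + 1, by simpa using hi, by simpa using hj, by simpa using hij, ?_⟩
  simp [translocate, List.getElem?_eq_getElem hi]

theorem List.Perm.reflTransGen_translocStep {α : Type*} {x y : List α} (h : x.Perm y) :
    Relation.ReflTransGen TranslocStep x y := by
  induction h with
  | nil => exact .refl
  | cons a _ ih => exact ih.lift (a :: ·) fun _ _ h => h.cons a
  | swap a b l =>
    refine .single ⟨0, 1, by simp, by simp, by simp, ?_⟩
    simp [translocate]
  | trans _ _ ih₁ ih₂ => exact ih₁.trans ih₂

theorem exists_chain_of_reflTransGen {α : Type*} {r : α → α → Prop} {x y : α}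
    (h : Relation.ReflTransGen r x y) :
    ∃ (m : ℕ) (g : ℕ → α), g 0 = x ∧ g m = y ∧ ∀ k < m, r (g k) (g (k + 1)) := by
  induction h using Relation.ReflTransGen.head_induction_on with
  | refl => exact ⟨0, fun _ => y, rfl, rfl, by simp⟩
  | @head a c hac _ ih =>
    obtain ⟨m, g, h0, hm, hg⟩ := ih
    refine ⟨m + 1, fun k => Nat.casesOn k a g, rfl, hm, ?_⟩
    rintro (_ | k) hk
    · simpa [h0] using hac
    · exact hg k (by omega)

theorem filter_translocate {α : Type*} (l : List α) (i j : ℕ) (hi : i < l.length)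
    (p : α → Bool) (hp : p l[i] = false) :
    (translocate l i j).filter p = l.filter p := by
  have h1 : ∀ (l : List α) (j : ℕ) (a : α), p a = false →
      (l.insertIdx j a).filter p = l.filter p := by
    intro l
    induction l with
    | nil => rintro (_ | j) a ha <;> simp [ha]
    | cons b l ih => rintro (_ | j) a ha <;> simp [ha, List.filter_cons, ih]
  have h2 : (l.eraseIdx i).filter p = l.filter p := by
    conv_rhs => rw [← List.take_append_drop i l, List.drop_eq_getElem_cons hi, List.filter_append,
      List.filter_cons_of_neg (by simp [hp])]
    rw [List.eraseIdx_eq_take_drop_succ, List.filter_append]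
  simp [translocate, List.getElem?_eq_getElem hi, h1 _ _ _ hp, h2]

/-- A chain of `m` translocations preserves the sequence outside at most `m` symbols. -/
theorem exists_filter_eq_of_chain {α : Type*} (g : ℕ → List α) (m : ℕ)
    (hg : ∀ k < m, TranslocStep (g k) (g (k + 1))) :
    ∃ A : Finset α, A.card ≤ m ∧ (g 0).filter (· ∉ A) = (g m).filter (· ∉ A) := by
  induction m with
  | zero => exact ⟨∅, by simp, rfl⟩
  | succ m ih =>
    obtain ⟨A, hA, h⟩ := ih fun k hk => hg k (by omega)
    obtain ⟨i, j, hi, -, -, hs⟩ := hg m (by omega)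
    refine ⟨insert (g m)[i] A, (Finset.card_insert_le _ _).trans (by omega), ?_⟩
    rw [hs, filter_translocate _ _ _ hi _ (by simp)]
    have key : ∀ l : List α, l.filter (· ∉ insert (g m)[i] A) =
        (l.filter (· ∉ A)).filter (· ≠ (g m)[i]) := by
      intro l
      rw [List.filter_filter]
      congr 1
      ext a
      simp [not_or]
    rw [key, key, h]

theorem seqOf_perm {n : ℕ} (σ π : Equiv.Perm (Fin n)) : (seqOf σ).Perm (seqOf π) := by
  have h : ∀ σ : Equiv.Perm (Fin n), (seqOf σ).Perm (List.ofFn fun i : Fin n => (i : ℕ) + 1) :=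
    fun σ => Equiv.Perm.ofFn_comp_perm σ fun i : Fin n => (i : ℕ) + 1
  exact (h σ).trans (h π).symm

/-- The position functions `f` and `g` order the symbols outside `A` in the same way. -/
def AgreeOff {n : ℕ} (A : Finset (Fin n)) (f g : Equiv.Perm (Fin n)) : Prop :=
  ∀ x ∉ A, ∀ y ∉ A, f x < f y ↔ g x < g y

theorem AgreeOff.mono {n : ℕ} {A B : Finset (Fin n)} {f g : Equiv.Perm (Fin n)}
    (h : AgreeOff A f g) (hAB : A ⊆ B) : AgreeOff B f g :=
  fun x hx y hy => h x (fun h => hx (hAB h)) y (fun h => hy (hAB h))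

theorem AgreeOff.symm {n : ℕ} {A : Finset (Fin n)} {f g : Equiv.Perm (Fin n)}
    (h : AgreeOff A f g) : AgreeOff A g f :=
  fun x hx y hy => (h x hx y hy).symm

theorem AgreeOff.trans {n : ℕ} {A : Finset (Fin n)} {f g k : Equiv.Perm (Fin n)}
    (h : AgreeOff A f g) (h' : AgreeOff A g k) : AgreeOff A f k :=
  fun x hx y hy => (h x hx y hy).trans (h' x hx y hy)

theorem exists_agreeOff_of_dU_le {n t : ℕ} {σ π : Equiv.Perm (Fin n)} (h : dU σ π ≤ t) :
    ∃ A : Finset (Fin n), A.card ≤ t ∧ AgreeOff A σ⁻¹ π⁻¹ := by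
  have hne : {m | ∃ g : ℕ → List ℕ, g 0 = seqOf σ ∧ g m = seqOf π ∧
      ∀ k < m, TranslocStep (g k) (g (k + 1))}.Nonempty :=
    exists_chain_of_reflTransGen (seqOf_perm σ π).reflTransGen_translocStep
  obtain ⟨g, h0, hm, hg⟩ := Nat.sInf_mem hne
  obtain ⟨A, hA, hf⟩ := exists_filter_eq_of_chain g _ hg
  replace hf : (seqOf σ).filter (· ∉ A) = (seqOf π).filter (· ∉ A) := by
    rw [h0, hm] at hf
    convert hf
  refine ⟨Finset.univ.filter fun x : Fin n => (x : ℕ) + 1 ∈ A, ?_, ?_⟩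
  · refine le_trans (Finset.card_le_card_of_injOn (fun x : Fin n => (x : ℕ) + 1) ?_ ?_)
      (hA.trans h)
    · intro x hx
      simpa using hx
    · intro x _ y _ hxy
      exact Fin.ext (by simpa using hxy)
  · have hpos : ∀ ρ : Equiv.Perm (Fin n), (seqOf ρ).Pairwise
        fun a b => ∀ x y : Fin n, (x : ℕ) + 1 = a → (y : ℕ) + 1 = b → ρ⁻¹ x < ρ⁻¹ y := by
      intro ρ
      rw [seqOf, List.pairwise_ofFn]
      intro i j hij x y hx hy
      have hx' : x = ρ i := Fin.ext (by omega)
      have hy' : y = ρ j := Fin.ext (by omega)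
      simpa [hx', hy'] using hij
    have hσ := (hpos σ).filter (· ∉ A)
    have hπ := (hpos π).filter (· ∉ A)
    rw [← hf] at hπ
    have hboth := hσ.and hπ
    have hmem : ∀ x : Fin n, (x : ℕ) + 1 ∉ A →
        (x : ℕ) + 1 ∈ (seqOf σ).filter (· ∉ A) := by
      intro x hx
      simp only [List.mem_filter, seqOf, List.mem_ofFn]
      exact ⟨⟨σ⁻¹ x, by simp⟩, by simpa using hx⟩
    intro x hx y hy
    simp only [Finset.mem_filter, Finset.mem_univ, true_and] at hx hy
    have hsymm : ∀ a ∈ (seqOf σ).filter (· ∉ A), ∀ b ∈ (seqOf σ).filter (· ∉ A),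
        ∀ x y : Fin n, (x : ℕ) + 1 = a → (y : ℕ) + 1 = b →
          (σ⁻¹ x < σ⁻¹ y ↔ π⁻¹ x < π⁻¹ y) := by
      refine fun a ha b hb => List.Pairwise.forall_of_forall_of_flip
        (R := fun a b => ∀ x y : Fin n, (x : ℕ) + 1 = a → (y : ℕ) + 1 = b →
          (σ⁻¹ x < σ⁻¹ y ↔ π⁻¹ x < π⁻¹ y)) ?_ ?_ ?_ ha hb
      · intro a _ x y hx hy
        have : x = y := Fin.ext (by omega)
        simp [this]
      · exact hboth.imp fun h x y hx hy => iff_of_true (h.1 x y hx hy) (h.2 x y hx hy)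
      · exact hboth.imp fun h x y hx hy => iff_of_false (h.1 y x hy hx).asymm
          (h.2 y x hy hx).asymm
    exact hsymm _ (hmem x hx) _ (hmem y hy) x y rfl rfl

theorem card_filter_apply_mem {α : Type*} [Fintype α] (f : Equiv.Perm α) (s : Finset α) :
    (Finset.univ.filter fun y => f y ∈ s).card = s.card :=
  Finset.card_bij (fun y _ => f y) (by simp) (fun _ _ _ _ h => f.injective h)
    fun b hb => ⟨f.symm b, by simpa using hb, by simp⟩

theorem card_filter_apply_lt {n : ℕ} (f : Equiv.Perm (Fin n)) (p : Fin n) :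
    (Finset.univ.filter fun y => f y < p).card = p := by
  simpa using card_filter_apply_mem f (Finset.Iio p)

theorem card_filter_apply_le {n : ℕ} (f : Equiv.Perm (Fin n)) (p : Fin n) :
    (Finset.univ.filter fun y => f y ≤ p).card = p + 1 := by
  simpa using card_filter_apply_mem f (Finset.Iic p)

theorem AgreeOff.apply_le_add_card {n : ℕ} {A : Finset (Fin n)} {f g : Equiv.Perm (Fin n)}
    (h : AgreeOff A f g) {x : Fin n} (hx : x ∉ A) : (f x : ℕ) ≤ g x + A.card := by
  rw [← card_filter_apply_lt f (f x), ← card_filter_apply_lt g (g x)]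
  refine le_trans (Finset.card_le_card ?_) (Finset.card_union_le _ _)
  intro y hy
  by_cases hyA : y ∈ A
  · simp [hyA]
  · simpa [hyA, ← h y hyA x hx] using hy

theorem AgreeOff.apply_le_of_eqOn {n : ℕ} {S : Finset (Fin n)} {f g : Equiv.Perm (Fin n)}
    (h : AgreeOff S f g) (heq : ∀ x ∈ S, f x = g x) (y : Fin n) : f y ≤ g y := by
  by_cases hy : y ∈ S
  · exact (heq y hy).le
  by_contra! hlt
  have hsub : (Finset.univ.filter fun z => f z ≤ g y) ⊆
      Finset.univ.filter fun z => g z < g y := by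
    intro z hz
    simp only [Finset.mem_filter, Finset.mem_univ, true_and] at hz ⊢
    by_cases hzS : z ∈ S
    · refine lt_of_le_of_ne (heq z hzS ▸ hz) fun hzy => hy ?_
      rwa [← g.injective hzy]
    · exact (h z hzS y hy).1 (hz.trans_lt hlt)
  have hcard := Finset.card_le_card hsub
  rw [card_filter_apply_le, card_filter_apply_lt] at hcard
  omega

theorem AgreeOff.eq_of_eqOn {n : ℕ} {S : Finset (Fin n)} {f g : Equiv.Perm (Fin n)}
    (h : AgreeOff S f g) (heq : ∀ x ∈ S, f x = g x) : f = g :=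
  Equiv.ext fun y => le_antisymm (h.apply_le_of_eqOn heq y)
    (h.symm.apply_le_of_eqOn (fun x hx => (heq x hx).symm) y)

/-- The points of `Fin n` at distance at most `r` from `a`. -/
def nearFinset {n : ℕ} (r : ℕ) (a : Fin n) : Finset (Fin n) :=
  Finset.univ.filter fun b => (a : ℕ) ≤ b + r ∧ (b : ℕ) ≤ a + r

theorem card_nearFinset_le {n : ℕ} (r : ℕ) (a : Fin n) : (nearFinset r a).card ≤ 2 * r + 1 := by
  have h : (nearFinset r a).card ≤ (Finset.Icc ((a : ℕ) - r) (a + r)).card := by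
    refine Finset.card_le_card_of_injOn (fun b => (b : ℕ)) ?_ fun _ _ _ _ h => Fin.ext h
    intro b hb
    simp only [nearFinset, Finset.coe_filter, Finset.mem_univ, true_and, Set.mem_ofPred_eq] at hb
    simp only [Finset.coe_Icc, Set.mem_Icc]
    omega
  rw [Nat.card_Icc] at h
  omega

theorem card_le_mul_of_forall_mem {α β : Type*} (T : Finset (α × β)) (U : Finset α)
    (V : α → Finset β) (u v : ℕ) (hU : U.card ≤ u) (hV : ∀ p, (V p).card ≤ v)
    (h : ∀ x ∈ T, x.1 ∈ U ∧ x.2 ∈ V x.1) : T.card ≤ u * v := by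
  calc T.card ≤ (U.sigma V).card :=
        Finset.card_le_card_of_injOn (fun x => ⟨x.1, x.2⟩)
          (fun x hx => by simpa using h x hx) (fun x _ y _ hxy => by
            simp only [Sigma.mk.injEq, heq_eq_eq] at hxy
            exact Prod.ext hxy.1 hxy.2)
    _ = ∑ p ∈ U, (V p).card := Finset.card_sigma _ _
    _ ≤ U.card * v := Finset.sum_le_card_nsmul _ _ _ fun p _ => hV p
    _ ≤ u * v := Nat.mul_le_mul_right _ hU

/-- The pairs of positions `(p, q)` such that `e` and `p` are close unless `a` holds, `p` and `q`
are close unless `b` holds, and `e` and `q` are close unless `c` holds. -/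
noncomputable def positionPairs {n : ℕ} (t : ℕ) (e : Fin n) (a b c : Prop) :
    Finset (Fin n × Fin n) :=
  Finset.univ.filter fun x =>
    (¬a → x.1 ∈ nearFinset t e) ∧ (¬b → x.2 ∈ nearFinset t x.1) ∧ (¬c → x.2 ∈ nearFinset t e)

theorem card_positionPairs_le {n : ℕ} (t : ℕ) (e : Fin n) (a b c : Prop)
    [Decidable a] [Decidable b] [Decidable c] (h : a ∨ b ∨ c) :
    (positionPairs t e a b c).card ≤ (4 * t + 1) ^ 2 *
      n ^ ((if a then 1 else 0) + (if b then 1 else 0) + (if c then 1 else 0) - 1) := by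
  have hn : (Finset.univ : Finset (Fin n)).card ≤ n := by simp
  have hN : ∀ a : Fin n, (nearFinset (2 * t) a).card ≤ 4 * t + 1 := fun a =>
    (card_nearFinset_le _ a).trans (by omega)
  have hK : 1 ≤ 4 * t + 1 := by omega
  have key := card_le_mul_of_forall_mem (positionPairs t e a b c)
  by_cases ha : a <;> by_cases hb : b <;> by_cases hc : c <;>
    simp only [ha, hb, hc, if_true, if_false, positionPairs, not_true, not_false_eq_true,
      false_implies, true_implies, true_and, and_true, or_self] at h key ⊢
  · refine (key Finset.univ (fun _ => Finset.univ) n n hn (fun _ => hn) (by simp)).trans ?_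
    calc n * n = 1 * (n * n) := (one_mul _).symm
      _ ≤ (4 * t + 1) ^ 2 * (n * n) := Nat.mul_le_mul_right _ (Nat.one_le_pow _ _ hK)
      _ = _ := by ring
  · refine (key Finset.univ (fun _ => nearFinset (2 * t) e) n _ hn (fun _ => hN e) ?_).trans ?_
    · simp only [nearFinset, Finset.mem_filter, Finset.mem_univ, true_and]; intros; omega
    · norm_num; nlinarith [Nat.mul_le_mul_left n (Nat.le_self_pow two_ne_zero (4 * t + 1))]
  · refine (key Finset.univ (nearFinset (2 * t)) n _ hn hN ?_).trans ?_
    · simp only [nearFinset, Finset.mem_filter, Finset.mem_univ, true_and]; intros; omega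
    · norm_num; nlinarith [Nat.mul_le_mul_left n (Nat.le_self_pow two_ne_zero (4 * t + 1))]
  · refine (key (nearFinset (2 * t) e) (fun _ => nearFinset (2 * t) e) _ _ (hN e)
      (fun _ => hN e) ?_).trans (by simp [sq])
    simp only [nearFinset, Finset.mem_filter, Finset.mem_univ, true_and]; intros; omega
  · refine (key (nearFinset (2 * t) e) (fun _ => Finset.univ) _ n (hN e) (fun _ => hn) ?_).trans ?_
    · simp only [nearFinset, Finset.mem_filter, Finset.mem_univ, true_and, and_true]; intros; omega
    · norm_num; nlinarith [Nat.mul_le_mul_left n (Nat.le_self_pow two_ne_zero (4 * t + 1))]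
  · refine (key (nearFinset (2 * t) e) (fun _ => nearFinset (2 * t) e) _ _ (hN e)
      (fun _ => hN e) ?_).trans (by simp [sq])
    simp only [nearFinset, Finset.mem_filter, Finset.mem_univ, true_and]; intros; omega
  · refine (key (nearFinset (2 * t) e) (nearFinset (2 * t)) _ _ (hN e) hN ?_).trans
      (by simp [sq])
    simp only [nearFinset, Finset.mem_filter, Finset.mem_univ, true_and]; intros; omega

/-- The pairs of permutations whose position functions agree with the position function `e` and
with each other outside prescribed sets of symbols. -/
noncomputable def agreeingPairs {n : ℕ} (e : Equiv.Perm (Fin n)) (A B C : Finset (Fin n)) :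
    Finset (Equiv.Perm (Fin n) × Equiv.Perm (Fin n)) :=
  Finset.univ.filter fun x =>
    AgreeOff A e x.1⁻¹ ∧ AgreeOff B x.1⁻¹ x.2⁻¹ ∧ AgreeOff C e x.2⁻¹

theorem card_agreeingPairs_le {n t : ℕ} (hn : 1 ≤ n) (e : Equiv.Perm (Fin n))
    {A B C S : Finset (Fin n)} (hS : A ∪ B ∪ C = S)
    (hA : A.card ≤ t) (hB : B.card ≤ t) (hC : C.card ≤ t) :
    (agreeingPairs e A B C).card ≤ ((4 * t + 1) ^ 2) ^ (3 * t) * n ^ (3 * t - S.card) := by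
  have hSt : S.card ≤ 3 * t := by
    have h1 := Finset.card_union_le (A ∪ B) C
    have h2 := Finset.card_union_le A B
    rw [hS] at h1
    omega
  have hAS : A ⊆ S := by rw [← hS]; intro x; simp; tauto
  have hBS : B ⊆ S := by rw [← hS]; intro x; simp; tauto
  have hCS : C ⊆ S := by rw [← hS]; intro x; simp; tauto
  have hnear : ∀ {D : Finset (Fin n)} {f g : Equiv.Perm (Fin n)}, AgreeOff D f g → D.card ≤ t →
      ∀ {x}, x ∉ D → g x ∈ nearFinset t (f x) := by
    intro D f g h hD x hx
    have h1 := h.apply_le_add_card hx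
    have h2 := h.symm.apply_le_add_card hx
    simp only [nearFinset, Finset.mem_filter, Finset.mem_univ, true_and]
    omega
  set m : Fin n → ℕ := fun x =>
    (if x ∈ A then 1 else 0) + (if x ∈ B then 1 else 0) + (if x ∈ C then 1 else 0) with hm
  have hm1 : ∀ x ∈ S, x ∈ A ∨ x ∈ B ∨ x ∈ C := by
    intro x hx
    rw [← hS] at hx
    simpa [or_assoc] using hx
  have hsum : ∑ x ∈ S, (m x - 1) ≤ 3 * t - S.card := by
    have h1 : ∑ x ∈ S, m x = A.card + B.card + C.card := by
      simp only [hm, Finset.sum_add_distrib, Finset.sum_ite_mem, Finset.sum_const, smul_eq_mul,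
        mul_one, Finset.inter_eq_right.2 hAS, Finset.inter_eq_right.2 hBS,
        Finset.inter_eq_right.2 hCS]
    have h2 : ∑ x ∈ S, (m x - 1) + S.card = ∑ x ∈ S, m x := by
      rw [Finset.card_eq_sum_ones, ← Finset.sum_add_distrib]
      refine Finset.sum_congr rfl fun x hx => ?_
      have : 1 ≤ m x := by
        rcases hm1 x hx with h | h | h <;> simp [hm, h] <;> omega
      omega
    omega
  calc (agreeingPairs e A B C).card
      ≤ (S.pi fun x => positionPairs t (e x) (x ∈ A) (x ∈ B) (x ∈ C)).card := by
        refine Finset.card_le_card_of_injOn (fun y x _ => (y.1⁻¹ x, y.2⁻¹ x)) ?_ ?_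
        · rintro ⟨π, τ⟩ hy
          simp only [agreeingPairs, Finset.coe_filter, Finset.mem_univ, true_and,
            Set.mem_ofPred_eq] at hy
          simp only [Finset.mem_coe, Finset.mem_pi, positionPairs, Finset.mem_filter,
            Finset.mem_univ, true_and]
          exact fun x _ => ⟨hnear hy.1 hA, hnear hy.2.1 hB, hnear hy.2.2 hC⟩
        · rintro ⟨π, τ⟩ hy ⟨π', τ'⟩ hy' heq
          simp only [agreeingPairs, Finset.coe_filter, Finset.mem_univ, true_and,
            Set.mem_ofPred_eq] at hy hy'
          have hx : ∀ x ∈ S, (π⁻¹ x, τ⁻¹ x) = (π'⁻¹ x, τ'⁻¹ x) := fun x hx =>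
            congrFun (congrFun heq x) hx
          refine Prod.ext (inv_injective ?_) (inv_injective ?_)
          · exact ((hy.1.symm.mono hAS).trans (hy'.1.mono hAS)).eq_of_eqOn
              fun x h => (Prod.ext_iff.1 (hx x h)).1
          · exact ((hy.2.2.symm.mono hCS).trans (hy'.2.2.mono hCS)).eq_of_eqOn
              fun x h => (Prod.ext_iff.1 (hx x h)).2
    _ = ∏ x ∈ S, (positionPairs t (e x) (x ∈ A) (x ∈ B) (x ∈ C)).card := Finset.card_pi _ _
    _ ≤ ∏ x ∈ S, (4 * t + 1) ^ 2 * n ^ (m x - 1) :=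
        Finset.prod_le_prod' fun x hx => card_positionPairs_le t (e x) _ _ _ (hm1 x hx)
    _ = ((4 * t + 1) ^ 2) ^ S.card * n ^ ∑ x ∈ S, (m x - 1) := by
        rw [Finset.prod_mul_distrib, Finset.prod_const, Finset.prod_pow_eq_pow_sum]
    _ ≤ _ := Nat.mul_le_mul (Nat.pow_le_pow_right (by positivity) hSt)
        (Nat.pow_le_pow_right hn hsum)

/-- The pairs completing `σ` to a triple of pairwise Ulam distance at most `t`. -/
noncomputable def trianglePairs {n : ℕ} (t : ℕ) (σ : Equiv.Perm (Fin n)) :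
    Finset (Equiv.Perm (Fin n) × Equiv.Perm (Fin n)) :=
  Finset.univ.filter fun x => dU σ x.1 ≤ t ∧ dU x.1 x.2 ≤ t ∧ dU σ x.2 ≤ t

theorem card_trianglePairs_le {n : ℕ} (t : ℕ) (hn : 1 ≤ n) (σ : Equiv.Perm (Fin n)) :
    (trianglePairs t σ).card ≤
      (3 * t + 1) * ((2 ^ (3 * t)) ^ 3 * ((4 * t + 1) ^ 2) ^ (3 * t)) * n ^ (3 * t) := by
  set K := ((4 * t + 1) ^ 2) ^ (3 * t)
  let F : Finset (Fin n) → Finset (Finset (Fin n) × Finset (Fin n) × Finset (Fin n)) := fun S =>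
    (S.powerset ×ˢ S.powerset ×ˢ S.powerset).filter fun D =>
      D.1 ∪ D.2.1 ∪ D.2.2 = S ∧ D.1.card ≤ t ∧ D.2.1.card ≤ t ∧ D.2.2.card ≤ t
  have hsub : trianglePairs t σ ⊆ (Finset.range (3 * t + 1)).biUnion fun s =>
      (Finset.powersetCard s Finset.univ).biUnion fun S =>
        (F S).biUnion fun D => agreeingPairs σ⁻¹ D.1 D.2.1 D.2.2 := by
    rintro ⟨π, τ⟩ hx
    simp only [trianglePairs, Finset.mem_filter, Finset.mem_univ, true_and] at hx
    obtain ⟨A, hA, hA'⟩ := exists_agreeOff_of_dU_le hx.1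
    obtain ⟨B, hB, hB'⟩ := exists_agreeOff_of_dU_le hx.2.1
    obtain ⟨C, hC, hC'⟩ := exists_agreeOff_of_dU_le hx.2.2
    simp only [Finset.mem_biUnion, Finset.mem_range, Finset.mem_powersetCard_univ]
    refine ⟨_, ?_, A ∪ B ∪ C, rfl, (A, B, C), ?_, ?_⟩
    · have h1 := Finset.card_union_le (A ∪ B) C
      have h2 := Finset.card_union_le A B
      omega
    · simp only [F, Finset.mem_filter, Finset.mem_product, Finset.mem_powerset]
      refine ⟨⟨?_, ?_, ?_⟩, trivial, hA, hB, hC⟩ <;> intro x <;> simp <;> tauto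
    · simp only [agreeingPairs, Finset.mem_filter, Finset.mem_univ, true_and]
      exact ⟨hA', hB', hC'⟩
  have hS : ∀ s ≤ 3 * t, ∀ S ∈ Finset.powersetCard s (Finset.univ : Finset (Fin n)),
      ((F S).biUnion fun D => agreeingPairs σ⁻¹ D.1 D.2.1 D.2.2).card ≤
        (2 ^ (3 * t)) ^ 3 * (K * n ^ (3 * t - s)) := by
    intro s hs S hS
    rw [Finset.mem_powersetCard_univ] at hS
    refine (Finset.card_biUnion_le_card_mul _ _ (K * n ^ (3 * t - s)) ?_).trans
      (Nat.mul_le_mul_right _ ?_)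
    · rintro ⟨A, B, C⟩ hD
      simp only [F, Finset.mem_filter] at hD
      rw [← hS]
      exact card_agreeingPairs_le hn _ hD.2.1 hD.2.2.1 hD.2.2.2.1 hD.2.2.2.2
    · calc (F S).card ≤ (S.powerset ×ˢ S.powerset ×ˢ S.powerset).card := Finset.card_filter_le _ _
        _ = (2 ^ s) ^ 3 := by
          rw [Finset.card_product, Finset.card_product, Finset.card_powerset, hS]; ring
        _ ≤ _ := Nat.pow_le_pow_left (Nat.pow_le_pow_right two_pos hs) 3
  refine (Finset.card_le_card hsub).trans ?_
  rw [mul_assoc]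
  conv_rhs => rw [← Finset.card_range (3 * t + 1)]
  refine Finset.card_biUnion_le_card_mul _ _ _ fun s hs => ?_
  have hst : s ≤ 3 * t := by simpa [Nat.lt_succ_iff] using hs
  refine (Finset.card_biUnion_le_card_mul _ _ _ (hS s hst)).trans ?_
  rw [Finset.card_powersetCard, Finset.card_univ, Fintype.card_fin]
  calc n.choose s * ((2 ^ (3 * t)) ^ 3 * (K * n ^ (3 * t - s)))
      ≤ n ^ s * ((2 ^ (3 * t)) ^ 3 * (K * n ^ (3 * t - s))) :=
        Nat.mul_le_mul_right _ (Nat.choose_le_pow n s)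
    _ = (2 ^ (3 * t)) ^ 3 * K * (n ^ s * n ^ (3 * t - s)) := by ring
    _ = _ := by rw [← pow_add, Nat.add_sub_cancel' hst]

/-- triangle count: for every fixed `t ≥ 1` there is a constant `C`
such that the number of triples `(σ,π,τ)` with pairwise Ulam distance at most `t`
is at most `C · n! · n^{3t}`. -/
theorem stmt4 (t : ℕ) (ht : 1 ≤ t) :
    ∃ C : ℕ, ∀ n : ℕ, 1 ≤ n →
      ({x : Equiv.Perm (Fin n) × Equiv.Perm (Fin n) × Equiv.Perm (Fin n) |
          dU x.1 x.2.1 ≤ t ∧ dU x.2.1 x.2.2 ≤ t ∧ dU x.1 x.2.2 ≤ t}).ncard ≤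
        C * n.factorial * n ^ (3 * t) := by
  refine ⟨(3 * t + 1) * ((2 ^ (3 * t)) ^ 3 * ((4 * t + 1) ^ 2) ^ (3 * t)), fun n hn => ?_⟩
  set K := (3 * t + 1) * ((2 ^ (3 * t)) ^ 3 * ((4 * t + 1) ^ 2) ^ (3 * t))
  have hcard := Finset.card_sigma (Finset.univ : Finset (Equiv.Perm (Fin n))) (trianglePairs t)
  calc _ ≤ (↑(Finset.univ.sigma (trianglePairs (n := n) t)) : Set (Σ _ : Equiv.Perm (Fin n),
          Equiv.Perm (Fin n) × Equiv.Perm (Fin n))).ncard := by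
        refine Set.ncard_le_ncard_of_injOn
          (fun x : Equiv.Perm (Fin n) × Equiv.Perm (Fin n) × Equiv.Perm (Fin n) =>
            (⟨x.1, x.2⟩ : Σ _ : Equiv.Perm (Fin n), Equiv.Perm (Fin n) × Equiv.Perm (Fin n)))
          ?_ ?_ (Finset.finite_toSet _)
        · intro x hx
          simpa [trianglePairs] using hx
        · intro x _ y _ hxy
          simp only [Sigma.mk.injEq, heq_eq_eq] at hxy
          exact Prod.ext hxy.1 hxy.2
    _ = ∑ σ, (trianglePairs t σ).card := by rw [Set.ncard_coe_finset, hcard]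
    _ ≤ (Finset.univ : Finset (Equiv.Perm (Fin n))).card * (K * n ^ (3 * t)) :=
        Finset.sum_le_card_nsmul _ _ _ fun σ _ => card_trianglePairs_le t hn σ
    _ = K * n.factorial * n ^ (3 * t) := by
        rw [Finset.card_univ, Fintype.card_perm, Fintype.card_fin]; ring
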